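/- For any boolean function f, bs(f)² − bs(f) ≤ (2/3)·(deg(f)⁴ − deg(f)²), and consequently bs(f) ≤ √(2/3)·deg(f)² + 1. -/

import Mathlib

open Finset
open scoped Classical

namespace BF

noncomputable section

/-- flip the bits of `x` belonging to `B`. -/
def flipS {n : ℕ} (x : Fin n → Bool) (B : Finset (Fin n)) : Fin n → Bool :=
  fun i => if i ∈ B then !(x i) else x i

/-- flip the `i`-th bit of `x`. -/
def flip1 {n : ℕ} (x : Fin n → Bool) (i : Fin n) : Fin n → Bool :=
  fun j => if j = i then !(x j) else x j

/-- real value of a boolean. -/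
def bval (b : Bool) : ℝ := if b then 1 else 0

/-- coefficient of the monomial `∏_{i ∈ S} x_i` in the unique multilinear
real polynomial expansion of `f` (Möbius inversion over the subcube lattice). -/
def coeffS {n : ℕ} (f : (Fin n → Bool) → ℝ) (S : Finset (Fin n)) : ℝ :=
  ∑ T ∈ S.powerset, (-1 : ℝ) ^ (S.card - T.card) * f (fun i => decide (i ∈ T))

/-- degree of the multilinear expansion of a real-valued function on the cube. -/
def degF {n : ℕ} (f : (Fin n → Bool) → ℝ) : ℕ :=
  (Finset.univ.filter fun S : Finset (Fin n) => coeffS f S ≠ 0).sup Finset.card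

/-- degree of a boolean function. -/
def degB {n : ℕ} (f : (Fin n → Bool) → Bool) : ℕ := degF (fun x => bval (f x))

/-- block sensitivity of `f` at `x`. -/
def bsAt {n : ℕ} (f : (Fin n → Bool) → Bool) (x : Fin n → Bool) : ℕ :=
  (Finset.univ.filter fun 𝓑 : Finset (Finset (Fin n)) =>
      (∀ B ∈ 𝓑, f (flipS x B) ≠ f x) ∧
      ∀ A ∈ 𝓑, ∀ B ∈ 𝓑, A ≠ B → Disjoint A B).sup Finset.card

/-- block sensitivity of `f`. -/
def bs {n : ℕ} (f : (Fin n → Bool) → Bool) : ℕ := Finset.univ.sup (bsAt f)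

/-- sensitivity of `f` at `x`. -/
def sx {n : ℕ} (f : (Fin n → Bool) → Bool) (x : Fin n → Bool) : ℕ :=
  (Finset.univ.filter fun i => f (flip1 x i) ≠ f x).card

/-- (maximum) sensitivity of `f`. -/
def sens {n : ℕ} (f : (Fin n → Bool) → Bool) : ℕ := Finset.univ.sup (sx f)

/-- coordinate `i` is relevant for `f`. -/
def Rel {n : ℕ} (i : Fin n) (f : (Fin n → Bool) → Bool) : Prop :=
  ∃ x, f (flip1 x i) ≠ f x

/-- the set of relevant coordinates of `f`. -/
def relSet {n : ℕ} (f : (Fin n → Bool) → Bool) : Finset (Fin n) :=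
  Finset.univ.filter fun i => Rel i f

/-- the number of relevant variables `n(f)`. -/
def nrel {n : ℕ} (f : (Fin n → Bool) → Bool) : ℕ := (relSet f).card

/-- influence of coordinate `i` on `f` (uniform distribution). -/
def infl {n : ℕ} (f : (Fin n → Bool) → Bool) (i : Fin n) : ℝ :=
  ((Finset.univ.filter fun x : Fin n → Bool => f x ≠ f (flip1 x i)).card : ℝ) / 2 ^ n

/-- total influence `I[f]`. -/
def totalInf {n : ℕ} (f : (Fin n → Bool) → Bool) : ℝ := ∑ i, infl f i

/-- restriction of `f` fixing the coordinates in `H` according to `α`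
(viewed as a function on the full cube not depending on the coordinates in `H`). -/
def restrict {n : ℕ} (f : (Fin n → Bool) → Bool) (H : Finset (Fin n))
    (α : Fin n → Bool) : (Fin n → Bool) → Bool :=
  fun x => f (fun i => if i ∈ H then α i else x i)

/-- certificate complexity of `f` at `x`. -/
def certAt {n : ℕ} (f : (Fin n → Bool) → Bool) (x : Fin n → Bool) : ℕ :=
  sInf {k | ∃ S : Finset (Fin n), S.card = k ∧
    ∀ y, (∀ i ∈ S, y i = x i) → f y = f x}

/-- certificate complexity `C(f)`. -/
def certC {n : ℕ} (f : (Fin n → Bool) → Bool) : ℕ := Finset.univ.sup (certAt f)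

/-- `f` is in standard form: `f(0) = 0` and `f(e_i) = 1` for every basis vector. -/
def stdForm {b : ℕ} (f : (Fin b → Bool) → Bool) : Prop :=
  f (fun _ => false) = false ∧ ∀ i : Fin b, f (fun j => decide (j = i)) = true

end

end BF

open BF

namespace BF

open Polynomial

noncomputable section

/-- The multilinear extension of the set function `h` on subsets of `s`, restricted to the
diagonal: the expectation of `h` over a random subset of `s` containing each element
independently with probability `X`. -/
def bern {ι : Type*} (s : Finset ι) (h : Finset ι → ℝ) : ℝ[X] :=
  ∑ Y ∈ s.powerset, C (h Y) * (X ^ Y.card * (1 - X) ^ (s.card - Y.card))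

section bern

variable {ι : Type*}

lemma bern_empty (h : Finset ι → ℝ) : bern ∅ h = C (h ∅) := by
  simp [bern]

lemma bern_congr {s : Finset ι} {h h' : Finset ι → ℝ} (H : ∀ Y ⊆ s, h Y = h' Y) :
    bern s h = bern s h' :=
  Finset.sum_congr rfl fun Y hY => by rw [H Y (Finset.mem_powerset.1 hY)]

lemma bern_insert [DecidableEq ι] {s : Finset ι} {a : ι} (ha : a ∉ s) (h : Finset ι → ℝ) :
    bern (insert a s) h = (1 - X) * bern s h + X * bern s (fun Y => h (insert a Y)) := by
  unfold bern
  rw [Finset.sum_powerset_insert ha, Finset.mul_sum, Finset.mul_sum,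
    Finset.card_insert_of_notMem ha]
  congr 1 <;> refine Finset.sum_congr rfl fun Y hY => ?_
  · have hc := Finset.card_le_card (Finset.mem_powerset.1 hY)
    rw [Nat.sub_add_comm hc]
    ring
  · rw [Finset.card_insert_of_notMem fun h' => ha (Finset.mem_powerset.1 hY h'),
      Nat.add_sub_add_right]
    ring

lemma bern_sum {κ : Type*} (s : Finset ι) (t : Finset κ) (c : κ → ℝ) (h : κ → Finset ι → ℝ) :
    bern s (fun Y => ∑ k ∈ t, c k * h k Y) = ∑ k ∈ t, C (c k) * bern s (h k) := by
  simp only [bern, map_sum, map_mul, Finset.sum_mul, Finset.mul_sum]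
  rw [Finset.sum_comm]
  exact Finset.sum_congr rfl fun k _ => Finset.sum_congr rfl fun Y _ => by ring

lemma bern_one_sub (s : Finset ι) (h : Finset ι → ℝ) :
    bern s (fun Y => 1 - h Y) = 1 - bern s h := by
  have h1 : ∑ Y ∈ s.powerset, (X : ℝ[X]) ^ Y.card * (1 - X) ^ (s.card - Y.card) = 1 := by
    rw [Finset.sum_pow_mul_eq_add_pow]
    simp
  simp only [bern, map_sub, map_one, sub_mul, one_mul, Finset.sum_sub_distrib, h1]

lemma natDegree_bern_le [DecidableEq ι] (s c : Finset ι) (h : Finset ι → ℝ)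
    (H : ∀ Y ⊆ s, h Y = h (Y ∩ c)) : (bern s h).natDegree ≤ c.card := by
  induction s using Finset.induction_on generalizing c h with
  | empty => simp [bern_empty]
  | insert a s ha ih =>
    rw [bern_insert ha]
    by_cases hac : a ∈ c
    · have hY : ∀ Y ⊆ s, Y ∩ c = Y ∩ c.erase a := fun Y hY => by
        ext i
        simp only [Finset.mem_inter, Finset.mem_erase]
        have : i ∈ Y → i ≠ a := fun hi e => ha (hY (e ▸ hi))
        tauto
      have h1 := ih (c.erase a) h fun Y hYs => by
        rw [H Y (hYs.trans (Finset.subset_insert a s)), hY Y hYs]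
      have h2 := ih (c.erase a) (fun Y => h (insert a Y)) fun Y hYs => by
        rw [H _ (Finset.insert_subset_insert a hYs), Finset.insert_inter_of_mem hac, hY Y hYs]
      have hcard := Finset.card_erase_add_one hac
      have hX : ((1 : ℝ[X]) - X).natDegree ≤ 1 := by
        compute_degree
      refine (natDegree_add_le _ _).trans (max_le ?_ ?_)
      · exact natDegree_mul_le.trans (by omega)
      · exact natDegree_mul_le.trans (by rw [natDegree_X]; omega)
    · have h2 : bern s (fun Y => h (insert a Y)) = bern s h := bern_congr fun Y hYs => by
        rw [H _ (Finset.insert_subset_insert a hYs), Finset.insert_inter_of_notMem hac,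
          ← H Y (hYs.trans (Finset.subset_insert a s))]
      rw [h2, ← add_mul, sub_add_cancel, one_mul]
      exact ih c h fun Y hYs => H Y (hYs.trans (Finset.subset_insert a s))

lemma eval_bern_nonneg {s : Finset ι} {h : Finset ι → ℝ} (h0 : ∀ Y, 0 ≤ h Y) {t : ℝ}
    (ht0 : 0 ≤ t) (ht1 : t ≤ 1) : 0 ≤ (bern s h).eval t := by
  rw [bern, eval_finsetSum]
  refine Finset.sum_nonneg fun Y _ => ?_
  simp only [eval_mul, eval_C, eval_pow, eval_X, eval_sub, eval_one]
  have := sub_nonneg.2 ht1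
  have := h0 Y
  positivity

lemma eval_bern_le_one {s : Finset ι} {h : Finset ι → ℝ} (h1 : ∀ Y, h Y ≤ 1) {t : ℝ}
    (ht0 : 0 ≤ t) (ht1 : t ≤ 1) : (bern s h).eval t ≤ 1 := by
  have := eval_bern_nonneg (s := s) (h := fun Y => 1 - h Y) (fun Y => sub_nonneg.2 (h1 Y)) ht0 ht1
  rw [bern_one_sub, eval_sub, eval_one] at this
  linarith

lemma coeff_zero_bern [DecidableEq ι] (s : Finset ι) (h : Finset ι → ℝ) :
    (bern s h).coeff 0 = h ∅ := by
  induction s using Finset.induction_on generalizing h with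
  | empty => simp [bern_empty]
  | insert a s ha ih => simp [bern_insert ha, sub_mul, ih]

lemma coeff_one_bern [DecidableEq ι] (s : Finset ι) (h : Finset ι → ℝ) :
    (bern s h).coeff 1 = ∑ i ∈ s, (h {i} - h ∅) := by
  induction s using Finset.induction_on generalizing h with
  | empty => simp [bern_empty]
  | insert a s ha ih =>
    simp only [bern_insert ha, sub_mul, one_mul, coeff_add, coeff_sub, coeff_X_mul, ih,
      coeff_zero_bern, Finset.sum_insert ha]
    rw [insert_empty_eq]
    ring

lemma coeff_two_bern_le [DecidableEq ι] (s : Finset ι) (h : Finset ι → ℝ)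
    (h0 : h ∅ = 0) (hs : ∀ i ∈ s, h {i} = 1) (h1 : ∀ Y, h Y ≤ 1) :
    (bern s h).coeff 2 ≤ -((s.card : ℝ) * (s.card - 1) / 2) := by
  induction s using Finset.induction_on with
  | empty => simp [bern_empty]
  | insert a s ha ih =>
    have hs' : ∀ i ∈ s, h {i} = 1 := fun i hi => hs i (Finset.mem_insert_of_mem hi)
    have e1 : (bern s h).coeff 1 = s.card := by
      rw [coeff_one_bern, Finset.sum_congr rfl fun i hi => by rw [hs' i hi, h0, sub_zero]]
      simp
    have e2 : (bern s (fun Y => h (insert a Y))).coeff 1 ≤ 0 := by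
      rw [coeff_one_bern]
      refine Finset.sum_nonpos fun i _ => ?_
      have ha1 := hs a (Finset.mem_insert_self a s)
      have := h1 (insert a {i})
      simp only [insert_empty_eq, ha1]
      linarith
    have := ih hs'
    rw [bern_insert ha, sub_mul, one_mul, coeff_add, coeff_sub, show (2 : ℕ) = 1 + 1 from rfl,
      coeff_X_mul, coeff_X_mul, e1, Finset.card_insert_of_notMem ha]
    push_cast
    linarith

end bern

/-- The V. A. Markov inequality for the second derivative, at an endpoint of `[0, 1]`. -/
lemma neg_coeff_two_le_of_mem_Icc {q : ℝ[X]} {d : ℕ} (hd : q.natDegree ≤ d)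
    (hq : ∀ t, 0 ≤ t → t ≤ 1 → 0 ≤ q.eval t ∧ q.eval t ≤ 1) :
    -q.coeff 2 ≤ ((d : ℝ) ^ 4 - (d : ℝ) ^ 2) / 3 := by
  set l : ℝ[X] := C (1 / 2) * (1 - X) with hl
  set P : ℝ[X] := 1 - 2 * q.comp l with hP
  have hlin : l.natDegree ≤ 1 := by
    rw [hl]
    compute_degree
  have hPdeg : P.degree ≤ d := by
    refine natDegree_le_iff_degree_le.1 ((natDegree_sub_le _ _).trans (max_le (by simp) ?_))
    refine natDegree_mul_le.trans ?_
    rw [natDegree_ofNat, zero_add, natDegree_comp]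
    nlinarith
  have hPbnd : ∀ x ∈ Set.Icc (-1 : ℝ) 1, |P.eval x| ≤ 1 := by
    rintro x ⟨hx1, hx2⟩
    obtain ⟨h0, h1⟩ := hq (1 / 2 * (1 - x)) (by linarith) (by linarith)
    have : P.eval x = 1 - 2 * q.eval (1 / 2 * (1 - x)) := by
      simp [hP, hl, eval_comp]
    rw [this, abs_le]
    constructor <;> linarith
  have key := Chebyshev.eval_iterate_derivative_le_of_forall_abs_le_one (k := 2) le_rfl hPdeg hPbnd
  have hT : (derivative^[2] (Chebyshev.T ℝ d)).eval 1 = ((d : ℝ) ^ 4 - (d : ℝ) ^ 2) / 3 := by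
    have := Chebyshev.iterate_derivative_T_eval_one (R := ℝ) d 2
    simp [Finset.prod_range_succ] at this ⊢
    linarith
  have hl' : derivative l = C (-1 / 2) := by
    rw [hl]
    simp [neg_div]
  have hPd : (derivative^[2] P).eval 1 = -q.coeff 2 := by
    have h2 : (derivative (derivative q)).eval 0 = 2 * q.coeff 2 := by
      rw [← coeff_zero_eq_eval_zero, coeff_derivative, coeff_derivative]
      norm_num
      ring
    have hl1 : l.eval 1 = 0 := by simp [hl]
    simp [hP, derivative_comp, hl', hl1, eval_comp, h2]
    ring
  rw [hPd, hT] at key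
  exact key

lemma sum_powerset_sum_powerset_neg_one_pow {ι : Type*} [DecidableEq ι] (A : Finset ι)
    (g : Finset ι → ℝ) :
    ∑ S ∈ A.powerset, ∑ T ∈ S.powerset, (-1 : ℝ) ^ (S.card - T.card) * g T = g A := by
  induction A using Finset.induction_on generalizing g with
  | empty => simp
  | insert a A ha ih =>
    rw [Finset.sum_powerset_insert ha, ← Finset.sum_add_distrib, ← ih fun T => g (insert a T)]
    refine Finset.sum_congr rfl fun S hS => ?_
    have haS : a ∉ S := fun h => ha (Finset.mem_powerset.1 hS h)
    rw [Finset.sum_powerset_insert haS, Finset.card_insert_of_notMem haS, ← add_assoc,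
      ← Finset.sum_add_distrib, Finset.sum_eq_zero, zero_add]
    · refine Finset.sum_congr rfl fun T hT => ?_
      rw [Finset.card_insert_of_notMem fun h => haS (Finset.mem_powerset.1 hT h),
        Nat.add_sub_add_right]
    · intro T hT
      rw [Nat.sub_add_comm (Finset.card_le_card (Finset.mem_powerset.1 hT)), pow_succ]
      ring

lemma eq_sum_coeffS {n : ℕ} (F : (Fin n → Bool) → ℝ) (y : Fin n → Bool) :
    F y = ∑ S : Finset (Fin n), coeffS F S * if ∀ i ∈ S, y i = true then 1 else 0 := by
  have h := sum_powerset_sum_powerset_neg_one_pow (Finset.univ.filter fun i => y i = true)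
    fun T => F fun i => decide (i ∈ T)
  have hy : (fun i => decide (i ∈ Finset.univ.filter fun i => y i = true)) = y := by
    ext i
    simp
  simp only [hy] at h
  simp only [mul_ite, mul_one, mul_zero]
  rw [← h, ← Finset.sum_filter]
  refine Finset.sum_congr ?_ fun S _ => rfl
  ext S
  simp [Finset.subset_iff]

lemma natDegree_bern_flipS_le {n : ℕ} (F : (Fin n → Bool) → ℝ) (x : Fin n → Bool)
    (s : Finset (Finset (Fin n))) (hs : ∀ A ∈ s, ∀ B ∈ s, A ≠ B → Disjoint A B) :
    (bern s fun Y => F (flipS x (Y.biUnion id))).natDegree ≤ degF F := by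
  rw [bern_congr fun Y _ => eq_sum_coeffS F (flipS x (Y.biUnion id)), bern_sum]
  refine natDegree_sum_le_of_forall_le _ _ fun S _ => ?_
  by_cases hS : coeffS F S = 0
  · simp [hS]
  have hSd : S.card ≤ degF F := Finset.le_sup (f := Finset.card) (by simpa using hS)
  refine (natDegree_C_mul_le _ _).trans (le_trans ?_ hSd)
  set c := s.filter fun B => ∃ i ∈ S, i ∈ B with hc
  have hcS : c.card ≤ S.card := by
    refine Finset.card_le_card_of_forall_subsingleton (fun B i => i ∈ B)
      (fun B hB => (Finset.mem_filter.1 hB).2) fun i _ A hA B hB => ?_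
    by_contra hAB
    exact Finset.disjoint_left.1 (hs A (Finset.mem_filter.1 hA.1).1 B
      (Finset.mem_filter.1 hB.1).1 hAB) hA.2 hB.2
  refine (natDegree_bern_le s c _ fun Y hY => ?_).trans hcS
  have : ∀ i ∈ S, flipS x (Y.biUnion id) i = flipS x ((Y ∩ c).biUnion id) i := fun i hi => by
    have : i ∈ Y.biUnion id ↔ i ∈ (Y ∩ c).biUnion id := by
      simp only [Finset.mem_biUnion, Finset.mem_inter, id, hc, Finset.mem_filter]
      exact ⟨fun ⟨B, hB, hiB⟩ => ⟨B, ⟨hB, hY hB, i, hi, hiB⟩, hiB⟩,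
        fun ⟨B, hB, hiB⟩ => ⟨B, hB.1, hiB⟩⟩
    simp only [flipS, this]
  have : (∀ i ∈ S, flipS x (Y.biUnion id) i = true) ↔
      ∀ i ∈ S, flipS x ((Y ∩ c).biUnion id) i = true :=
    forall₂_congr fun i hi => by rw [this i hi]
  simp only [this]

lemma bval_nonneg (b : Bool) : 0 ≤ bval b := by
  cases b <;> simp [bval]

lemma bval_le_one (b : Bool) : bval b ≤ 1 := by
  cases b <;> simp [bval]

lemma card_mul_card_sub_one_le_degB {n : ℕ} (f : (Fin n → Bool) → Bool) (x : Fin n → Bool)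
    (s : Finset (Finset (Fin n))) (hf : ∀ B ∈ s, f (flipS x B) ≠ f x)
    (hs : ∀ A ∈ s, ∀ B ∈ s, A ≠ B → Disjoint A B) :
    (s.card : ℝ) * (s.card - 1) ≤ 2 / 3 * ((degB f : ℝ) ^ 4 - (degB f : ℝ) ^ 2) := by
  set h : Finset (Finset (Fin n)) → ℝ := fun Y => bval (f (flipS x (Y.biUnion id))) with hh
  have hdeg : (bern s h).natDegree ≤ degB f :=
    natDegree_bern_flipS_le (fun y => bval (f y)) x s hs
  have hx : flipS x ∅ = x := by
    ext i
    simp [flipS]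
  have of_std : ∀ g : Finset (Finset (Fin n)) → ℝ, (bern s g).natDegree ≤ degB f →
      g ∅ = 0 → (∀ B ∈ s, g {B} = 1) → (∀ Y, 0 ≤ g Y) → (∀ Y, g Y ≤ 1) →
      (s.card : ℝ) * (s.card - 1) ≤ 2 / 3 * ((degB f : ℝ) ^ 4 - (degB f : ℝ) ^ 2) := by
    intro g hg g0 gs gnonneg gle
    have h1 := coeff_two_bern_le s g g0 gs gle
    have h2 := neg_coeff_two_le_of_mem_Icc hg fun t ht0 ht1 =>
      ⟨eval_bern_nonneg gnonneg ht0 ht1, eval_bern_le_one gle ht0 ht1⟩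
    linarith
  cases hfx : f x with
  | false =>
    refine of_std h hdeg ?_ (fun B hB => ?_) (fun Y => bval_nonneg _) fun Y => bval_le_one _
    · simp [hh, hx, hfx, bval]
    · have := hf B hB
      rw [hfx] at this
      simp [hh, bval, this]
  | true =>
    refine of_std (fun Y => 1 - h Y) ?_ ?_ (fun B hB => ?_)
      (fun Y => sub_nonneg.2 (bval_le_one _)) fun Y => sub_le_self _ (bval_nonneg _)
    · rw [bern_one_sub]
      exact (natDegree_sub_le _ _).trans (max_le (by simp) hdeg)
    · simp [hh, hx, hfx, bval]
    · have := hf B hB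
      rw [hfx] at this
      simp [hh, bval, this]

lemma exists_card_eq_bs {n : ℕ} (f : (Fin n → Bool) → Bool) :
    ∃ (x : Fin n → Bool) (s : Finset (Finset (Fin n))), (∀ B ∈ s, f (flipS x B) ≠ f x) ∧
      (∀ A ∈ s, ∀ B ∈ s, A ≠ B → Disjoint A B) ∧ s.card = bs f := by
  obtain ⟨x, -, hx⟩ := Finset.exists_mem_eq_sup Finset.univ Finset.univ_nonempty (bsAt f)
  obtain ⟨s, hs, hsc⟩ := Finset.exists_mem_eq_sup (Finset.univ.filter
    fun 𝓑 : Finset (Finset (Fin n)) => (∀ B ∈ 𝓑, f (flipS x B) ≠ f x) ∧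
      ∀ A ∈ 𝓑, ∀ B ∈ 𝓑, A ≠ B → Disjoint A B) ⟨∅, by simp⟩ Finset.card
  obtain ⟨h1, h2⟩ := (Finset.mem_filter.1 hs).2
  refine ⟨x, s, h1, h2, ?_⟩
  rw [bs, hx, bsAt, ← hsc]

end

end BF

/-- `bs(f)² − bs(f) ≤ (2/3)(deg(f)⁴ − deg(f)²)` and consequently
`bs(f) ≤ √(2/3)·deg(f)² + 1`. -/
theorem stmt3 {n : ℕ} (f : (Fin n → Bool) → Bool) :
    (bs f : ℝ) ^ 2 - (bs f : ℝ) ≤ 2 / 3 * ((degB f : ℝ) ^ 4 - (degB f : ℝ) ^ 2) ∧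
    (bs f : ℝ) ≤ Real.sqrt (2 / 3) * (degB f : ℝ) ^ 2 + 1 := by
  have h1 : (bs f : ℝ) ^ 2 - (bs f : ℝ) ≤ 2 / 3 * ((degB f : ℝ) ^ 4 - (degB f : ℝ) ^ 2) := by
    obtain ⟨x, s, hf, hs, hc⟩ := exists_card_eq_bs f
    have := card_mul_card_sub_one_le_degB f x s hf hs
    rw [hc] at this
    linarith
  refine ⟨h1, ?_⟩
  rcases Nat.eq_zero_or_pos (bs f) with h0 | hpos
  · rw [h0, Nat.cast_zero]
    positivity
  · have hb : (1 : ℝ) ≤ bs f := by exact_mod_cast hpos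
    have hsq : Real.sqrt (2 / 3) ^ 2 = 2 / 3 := Real.sq_sqrt (by norm_num)
    have h2 : ((bs f : ℝ) - 1) ^ 2 ≤ (Real.sqrt (2 / 3) * (degB f : ℝ) ^ 2) ^ 2 := by
      rw [mul_pow, hsq]
      nlinarith [sq_nonneg (degB f : ℝ)]
    have h3 := abs_le_of_sq_le_sq' h2 (by positivity)
    linarith [h3.2]
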